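/- Let π be an irreducible ψ-generic representation of the quasi-split non-split group SO_{2l} with normalized Bessel function B_{π,ψ}. Let 1 ≤ n < l−1, let w′ ∈ W(GL_n), set w = t_n(w′)·w̃_n ∈ B_n(SO_{2l}) (as a matrix in SO_{2l}), and let t = diag(t_1,…,t_{l−1}, [[a, bρ],[b, a]], t_{l−1}^{−1},…,t_1^{−1}) ∈ T. If B_{π,ψ}(t·w) ≠ 0, then a = t_{n+1} = t_{n+2} = ⋯ = t_{l−1}, this common value is 1 or −1, and b = 0. -/

import Mathlib

open scoped MatrixGroups
open Matrix

noncomputable section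

namespace ConverseSO

open Classical in
/-- Evaluate a function defined on `G` at a point of `M` through the (typically injective)
map `c : G → M`, extending by zero. -/
def matFun {G M R : Type*} [Zero R] (c : G → M) (φ : G → R) (m : M) : R :=
  if h : ∃ g, c g = m then φ h.choose else 0

variable (F : Type) [Field F] [Fintype F]

/-- The antidiagonal matrix `J_m`. -/
def Jmat (m : ℕ) : Matrix (Fin m) (Fin m) F :=
  Matrix.of fun i j => if (i : ℕ) + (j : ℕ) + 1 = m then 1 else 0

/-- The middle-block modification `diag(I_{l-1}, [[0,1],[-ρ,0]], I_{l-1})`. -/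
def Dmat (l : ℕ) (ρ : F) : Matrix (Fin (2*l)) (Fin (2*l)) F :=
  Matrix.of fun i j =>
    if (i : ℕ) = l - 1 ∧ (j : ℕ) = l then 1
    else if (i : ℕ) = l ∧ (j : ℕ) = l - 1 then -ρ
    else if i = j ∧ (i : ℕ) ≠ l - 1 ∧ (i : ℕ) ≠ l then 1
    else 0

/-- `J_{2l,ρ}`. -/
def Jrho (l : ℕ) (ρ : F) : Matrix (Fin (2*l)) (Fin (2*l)) F := Dmat F l ρ * Jmat F (2*l)

/-- The matrix-level special orthogonal "set" attached to a matrix `Jm`. -/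
def SOset (m : ℕ) (Jm : Matrix (Fin m) (Fin m) F) : Set (Matrix (Fin m) (Fin m) F) :=
  {g | g.det = 1 ∧ gᵀ * Jm * g = Jm}

/-- The special orthogonal group attached to a matrix `Jm`, as a subgroup of `GL`. -/
def SOgrp (m : ℕ) (Jm : Matrix (Fin m) (Fin m) F) : Subgroup (GL (Fin m) F) where
  carrier := {g | ((g : Matrix (Fin m) (Fin m) F)).det = 1 ∧
    ((g : Matrix (Fin m) (Fin m) F))ᵀ * Jm * ((g : Matrix (Fin m) (Fin m) F)) = Jm}
  one_mem' := ⟨by simp, by simp⟩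
  mul_mem' := by
    rintro a b ⟨ha1, ha2⟩ ⟨hb1, hb2⟩
    refine ⟨by rw [Units.val_mul, Matrix.det_mul, ha1, hb1, one_mul], ?_⟩
    have hab : ((a * b : GL (Fin m) F) : Matrix (Fin m) (Fin m) F)
        = (a : Matrix (Fin m) (Fin m) F) * (b : Matrix (Fin m) (Fin m) F) := Units.val_mul a b
    rw [hab, Matrix.transpose_mul]
    calc (b : Matrix (Fin m) (Fin m) F)ᵀ * (a : Matrix (Fin m) (Fin m) F)ᵀ * Jm *
          ((a : Matrix (Fin m) (Fin m) F) * (b : Matrix (Fin m) (Fin m) F))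
        = (b : Matrix (Fin m) (Fin m) F)ᵀ *
            ((a : Matrix (Fin m) (Fin m) F)ᵀ * Jm * (a : Matrix (Fin m) (Fin m) F)) *
            (b : Matrix (Fin m) (Fin m) F) := by
          simp only [mul_assoc]
      _ = Jm := by rw [ha2, hb2]
  inv_mem' := by
    intro g hg
    obtain ⟨h1, h2⟩ := hg
    have hv1 : ((g⁻¹ : GL (Fin m) F) : Matrix (Fin m) (Fin m) F) * (g : Matrix (Fin m) (Fin m) F)
        = 1 := by rw [← Units.val_mul, inv_mul_cancel, Units.val_one]
    have hv2 : (g : Matrix (Fin m) (Fin m) F) * ((g⁻¹ : GL (Fin m) F) : Matrix (Fin m) (Fin m) F)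
        = 1 := by rw [← Units.val_mul, mul_inv_cancel, Units.val_one]
    constructor
    · have hd := congrArg Matrix.det hv1
      rw [Matrix.det_mul, h1, mul_one, Matrix.det_one] at hd
      exact hd
    · calc ((g⁻¹ : GL (Fin m) F) : Matrix (Fin m) (Fin m) F)ᵀ * Jm *
            ((g⁻¹ : GL (Fin m) F) : Matrix (Fin m) (Fin m) F)
          = ((g⁻¹ : GL (Fin m) F) : Matrix (Fin m) (Fin m) F)ᵀ *
              ((g : Matrix (Fin m) (Fin m) F)ᵀ * Jm * (g : Matrix (Fin m) (Fin m) F)) *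
              ((g⁻¹ : GL (Fin m) F) : Matrix (Fin m) (Fin m) F) := by rw [h2]
        _ = ((g : Matrix (Fin m) (Fin m) F) *
              ((g⁻¹ : GL (Fin m) F) : Matrix (Fin m) (Fin m) F))ᵀ * Jm *
              ((g : Matrix (Fin m) (Fin m) F) *
              ((g⁻¹ : GL (Fin m) F) : Matrix (Fin m) (Fin m) F)) := by
            rw [Matrix.transpose_mul]; simp only [mul_assoc]
        _ = Jm := by rw [hv2]; simp

/-- The quasi-split even special orthogonal group `SO_{2l}` attached to `J_{2l,ρ}`. -/
abbrev SO2l (l : ℕ) (ρ : F) : Subgroup (GL (Fin (2*l)) F) := SOgrp F (2*l) (Jrho F l ρ)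

/-- The odd special orthogonal group `SO_{2m+1}` (split form). -/
abbrev SOodd (m : ℕ) : Subgroup (GL (Fin (2*m+1)) F) := SOgrp F (2*m+1) (Jmat F (2*m+1))

/-- The underlying matrix of an element of a special orthogonal group. -/
def mat {m : ℕ} {Jm : Matrix (Fin m) (Fin m) F} (g : SOgrp F m Jm) :
    Matrix (Fin m) (Fin m) F :=
  ((g : GL (Fin m) F) : Matrix (Fin m) (Fin m) F)

/-- Upper triangular unipotent predicate for matrices. -/
def upUnip {m : ℕ} (M : Matrix (Fin m) (Fin m) F) : Prop :=
  ∀ i j : Fin m, (j : ℕ) ≤ (i : ℕ) → M i j = if i = j then 1 else 0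

/-- The upper triangular unipotent subgroup (as a set) of `SO_{2l}`. -/
def USet (l : ℕ) (ρ : F) : Set (SO2l F l ρ) := {u | upUnip F (mat F u)}

/-- The upper triangular unipotent matrices in `SO_{2m+1}` (matrix level). -/
def UoddMatSet (m : ℕ) : Set (Matrix (Fin (2*m+1)) (Fin (2*m+1)) F) :=
  {g | g ∈ SOset F (2*m+1) (Jmat F (2*m+1)) ∧ upUnip F g}

/-- The generic character of the upper unipotent subgroup of `SO_{2l}`:
`ψ(u_{1,2} + ⋯ + u_{l-2,l-1} + (1/2)·u_{l-1,l+1})` (1-indexed). -/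
def psiU (l : ℕ) (ψ : AddChar F ℂ) (M : Matrix (Fin (2*l)) (Fin (2*l)) F) : ℂ :=
  ψ (∑ i : Fin (2*l), ∑ j : Fin (2*l),
    (if (j : ℕ) = (i : ℕ) + 1 ∧ (i : ℕ) + 3 ≤ l then M i j
     else if (i : ℕ) + 2 = l ∧ (j : ℕ) = l then (2 : F)⁻¹ * M i j else 0))

/-- The sum `u_{1,2} + ⋯ + u_{n-1,n}` for an `n × n` matrix. -/
def glUSum (n : ℕ) (M : Matrix (Fin n) (Fin n) F) : F :=
  ∑ i : Fin n, ∑ j : Fin n, (if (j : ℕ) = (i : ℕ) + 1 then M i j else 0)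

/-- The character `ψ_γ` of `N^{l-n}`:
`ψ(Σ_{i=1}^{l-n-1} v_{i,i+1} + (1/2)·v_{l-n-1,l+1})` (1-indexed). -/
def psiGam (l n : ℕ) (ψ : AddChar F ℂ) (M : Matrix (Fin (2*l)) (Fin (2*l)) F) : ℂ :=
  ψ (∑ i : Fin (2*l), ∑ j : Fin (2*l),
    (if (j : ℕ) = (i : ℕ) + 1 ∧ (i : ℕ) + 2 + n ≤ l then M i j
     else if (i : ℕ) + 2 + n = l ∧ (j : ℕ) = l then (2 : F)⁻¹ * M i j else 0))

/-- Irreducibility of a representation. -/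
def IsIrrep {G V : Type*} [Group G] [AddCommGroup V] [Module ℂ V]
    (π : Representation ℂ G V) : Prop :=
  (∃ v : V, v ≠ 0) ∧
    ∀ W : Submodule ℂ V, (∀ g : G, ∀ v ∈ W, π g v ∈ W) → W = ⊥ ∨ W = ⊤

/-- Block index function determined by a set `C` of cuts (and their mirrors) for `SO_{2l}`. -/
def blkCut (l : ℕ) (C : Finset ℕ) (i : ℕ) : ℕ :=
  (C.filter (fun c => c ≤ i)).card + (C.filter (fun c => 2*l - c ≤ i)).card

/-- The unipotent radical of the standard parabolic subgroup of `SO_{2l}` given by cuts `C`. -/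
def cuspUnip (l : ℕ) (ρ : F) (C : Finset ℕ) : Set (SO2l F l ρ) :=
  {g | ∀ i j : Fin (2*l), blkCut l C (j : ℕ) ≤ blkCut l C (i : ℕ) →
    mat F g i j = if i = j then 1 else 0}

/-- Cuspidality: the full unipotent-radical sums vanish for every proper standard parabolic. -/
def IsCuspidal (l : ℕ) (ρ : F) {V : Type*} [AddCommGroup V] [Module ℂ V]
    (π : Representation ℂ (SO2l F l ρ) V) : Prop :=
  ∀ C : Finset ℕ, C.Nonempty → (∀ c ∈ C, 1 ≤ c ∧ c ≤ l - 1) →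
    ∀ v : V, (∑ᶠ u ∈ cuspUnip F l ρ C, π u v) = 0

/-- `Γ` is a (nonzero) `ψ`-Whittaker functional for `π`. -/
def IsWhittaker (l : ℕ) (ρ : F) (ψ : AddChar F ℂ) {V : Type*} [AddCommGroup V] [Module ℂ V]
    (π : Representation ℂ (SO2l F l ρ) V) (Γ : V →ₗ[ℂ] ℂ) : Prop :=
  Γ ≠ 0 ∧ ∀ u ∈ USet F l ρ, ∀ v : V, Γ (π u v) = psiU F l ψ (mat F u) * Γ v

/-- `v₀` is a Whittaker vector with `Γ v₀ ≠ 0`. -/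
def IsWhitVec (l : ℕ) (ρ : F) (ψ : AddChar F ℂ) {V : Type*} [AddCommGroup V] [Module ℂ V]
    (π : Representation ℂ (SO2l F l ρ) V) (Γ : V →ₗ[ℂ] ℂ) (v₀ : V) : Prop :=
  Γ v₀ ≠ 0 ∧ ∀ u ∈ USet F l ρ, π u v₀ = psiU F l ψ (mat F u) • v₀

/-- The normalized Bessel function attached to the Whittaker data `(Γ, v₀)`. -/
def Bessel (l : ℕ) (ρ : F) {V : Type*} [AddCommGroup V] [Module ℂ V]
    (π : Representation ℂ (SO2l F l ρ) V) (Γ : V →ₗ[ℂ] ℂ) (v₀ : V) :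
    SO2l F l ρ → ℂ :=
  fun g => Γ (π g v₀) / Γ v₀

/-- Equality of central characters. -/
def SameCentralChar (l : ℕ) (ρ : F) {V V' : Type*} [AddCommGroup V] [Module ℂ V]
    [AddCommGroup V'] [Module ℂ V'] (π : Representation ℂ (SO2l F l ρ) V)
    (π' : Representation ℂ (SO2l F l ρ) V') : Prop :=
  ∃ ω : ℂ, (∀ g : SO2l F l ρ, mat F g = -1 → ∀ v : V, π g v = ω • v) ∧
    (∀ g : SO2l F l ρ, mat F g = -1 → ∀ v' : V', π' g v' = ω • v')
/-- `a^* = J_n · (a⁻¹)ᵀ · J_n`. -/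
def aStar (n : ℕ) (a : Matrix (Fin n) (Fin n) F) : Matrix (Fin n) (Fin n) F :=
  Jmat F n * (a⁻¹)ᵀ * Jmat F n

/-- The permutation matrix of `σ`. -/
def permMat (n : ℕ) (σ : Equiv.Perm (Fin n)) : Matrix (Fin n) (Fin n) F :=
  Matrix.of fun i j => if σ j = i then 1 else 0

/-- `t_n(a) = diag(a, I_{2l-2n}, a^*)` inside `2l × 2l` matrices. -/
def tnMat (l n : ℕ) (a : Matrix (Fin n) (Fin n) F) : Matrix (Fin (2*l)) (Fin (2*l)) F :=
  Matrix.of fun i j =>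
    if hi : (i : ℕ) < n then (if hj : (j : ℕ) < n then a ⟨i, hi⟩ ⟨j, hj⟩ else 0)
    else if hi2 : (i : ℕ) < 2*l - n then (if i = j then 1 else 0)
    else if hj2 : 2*l - n ≤ (j : ℕ) then
      aStar F n a ⟨(i : ℕ) - (2*l - n), by have := i.isLt; omega⟩
        ⟨(j : ℕ) - (2*l - n), by have := j.isLt; omega⟩
    else 0

/-- The Weyl representative `w̃_n` of `SO_{2l}` as a block matrix. -/
def wTildeMat (l n : ℕ) : Matrix (Fin (2*l)) (Fin (2*l)) F :=
  Matrix.of fun i j =>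
    if (i : ℕ) < n then (if (j : ℕ) = (i : ℕ) + (2*l - n) then 1 else 0)
    else if (i : ℕ) < l - 1 then (if i = j then 1 else 0)
    else if (i : ℕ) = l - 1 then (if i = j then (-1)^n else 0)
    else if (i : ℕ) < 2*l - n then (if i = j then 1 else 0)
    else (if (j : ℕ) + (2*l - n) = (i : ℕ) then 1 else 0)

/-- The torus matrix `diag(t_1,…,t_{l-1}, [[a,bρ],[b,a]], t_{l-1}⁻¹,…,t_1⁻¹)`. -/
def torusMat (l : ℕ) (ρ : F) (tv : ℕ → Fˣ) (a b : F) :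
    Matrix (Fin (2*l)) (Fin (2*l)) F :=
  Matrix.of fun i j =>
    if (i : ℕ) < l - 1 then (if i = j then (tv (i : ℕ) : F) else 0)
    else if (i : ℕ) = l - 1 then
      (if (j : ℕ) = l - 1 then a else if (j : ℕ) = l then b * ρ else 0)
    else if (i : ℕ) = l then
      (if (j : ℕ) = l - 1 then b else if (j : ℕ) = l then a else 0)
    else (if i = j then ((tv (2*l - 1 - (i : ℕ)))⁻¹ : F) else 0)

/-- The outer element `c = diag(I_{l-1}, 1, -1, I_{l-1})`. -/
def cMat (l : ℕ) : Matrix (Fin (2*l)) (Fin (2*l)) F :=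
  Matrix.of fun i j => if i = j then (if (i : ℕ) = l then -1 else 1) else 0

/-- The torus element `t̃ = diag(I_{l-1}, -1, -1, I_{l-1})`. -/
def tTildeMat (l : ℕ) : Matrix (Fin (2*l)) (Fin (2*l)) F :=
  Matrix.of fun i j =>
    if i = j then (if (i : ℕ) = l - 1 ∨ (i : ℕ) = l then -1 else 1) else 0

/-- `l_n(a) = diag(a, 1, a^*)` inside `(2n+1) × (2n+1)` matrices. -/
def lnMat (n : ℕ) (a : Matrix (Fin n) (Fin n) F) :
    Matrix (Fin (2*n+1)) (Fin (2*n+1)) F :=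
  Matrix.of fun i j =>
    if hi : (i : ℕ) < n then (if hj : (j : ℕ) < n then a ⟨i, hi⟩ ⟨j, hj⟩ else 0)
    else if hi2 : (i : ℕ) = n then (if i = j then 1 else 0)
    else if hj2 : n + 1 ≤ (j : ℕ) then
      aStar F n a ⟨(i : ℕ) - (n+1), by have := i.isLt; omega⟩
        ⟨(j : ℕ) - (n+1), by have := j.isLt; omega⟩
    else 0

/-- The Weyl element `w_n` of `SO_{2n+1}` with block rows `(0,0,I_n)`, `(0,(-1)^n,0)`, `(I_n,0,0)`. -/
def wnOddMat (n : ℕ) : Matrix (Fin (2*n+1)) (Fin (2*n+1)) F :=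
  Matrix.of fun i j =>
    if (i : ℕ) < n then (if (j : ℕ) = (i : ℕ) + n + 1 then 1 else 0)
    else if (i : ℕ) = n then (if i = j then (-1)^n else 0)
    else (if (j : ℕ) + n + 1 = (i : ℕ) then 1 else 0)

/-- `d_n = diag(-1, 1, …, (-1)^n)`. -/
def dnMat (n : ℕ) : Matrix (Fin n) (Fin n) F :=
  Matrix.of fun i j => if i = j then (-1)^((i : ℕ) + 1) else 0

/-- The block permutation matrix `w^{l,n}` of `SO_{2l}`. -/
def wlnMat (l n : ℕ) : Matrix (Fin (2*l)) (Fin (2*l)) F :=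
  Matrix.of fun i j =>
    if (i : ℕ) < n then (if (j : ℕ) = (i : ℕ) + (l - n - 1) then 1 else 0)
    else if (i : ℕ) < l - 1 then (if (j : ℕ) + n = (i : ℕ) then 1 else 0)
    else if (i : ℕ) < l + 1 then (if i = j then 1 else 0)
    else if (i : ℕ) < 2*l - n then (if (j : ℕ) = (i : ℕ) + n then 1 else 0)
    else (if (j : ℕ) + (l - n - 1) = (i : ℕ) then 1 else 0)

/-- `w_{l,l} = diag(γ·I_l, 1, γ⁻¹·I_l)` with `γ = ρ/2`. -/
def wllMat (l : ℕ) (ρ : F) : Matrix (Fin (2*l+1)) (Fin (2*l+1)) F :=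
  Matrix.of fun i j =>
    if i = j then
      (if (i : ℕ) < l then ρ/2 else if (i : ℕ) = l then 1 else (ρ/2)⁻¹)
    else 0

/-- The conjugating matrix `M` for the embedding of `SO_{2l}` into `SO_{2l+1}`. -/
def Mtop (l : ℕ) (ρ : F) : Matrix (Fin (2*l+1)) (Fin (2*l+1)) F :=
  Matrix.of fun i j =>
    if (i : ℕ) + 2 = l + 1 then (if (j : ℕ) = l then 1 else 0)
    else if (i : ℕ) = l then
      (if (j : ℕ) + 2 = l + 1 then (2 : F)⁻¹
       else if (j : ℕ) = l + 1 then (2 * (ρ/2))⁻¹ else 0)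
    else if (i : ℕ) = l + 1 then
      (if (j : ℕ) + 2 = l + 1 then (2 : F)⁻¹
       else if (j : ℕ) = l + 1 then -(2 * (ρ/2))⁻¹ else 0)
    else if i = j then 1 else 0

/-- Insert a trivial `(l+1)`-st row and column (1-indexed) into a `2l × 2l` matrix. -/
def insTop (l : ℕ) (g : Matrix (Fin (2*l)) (Fin (2*l)) F) :
    Matrix (Fin (2*l+1)) (Fin (2*l+1)) F :=
  Matrix.of fun i j =>
    if hi : (i : ℕ) = l then (if (j : ℕ) = l then 1 else 0)
    else if hj : (j : ℕ) = l then 0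
    else
      g ⟨if (i : ℕ) < l then (i : ℕ) else (i : ℕ) - 1, by have := i.isLt; split <;> omega⟩
        ⟨if (j : ℕ) < l then (j : ℕ) else (j : ℕ) - 1, by have := j.isLt; split <;> omega⟩

/-- The embedding of `SO_{2l}` into `SO_{2l+1}` at the matrix level. -/
def embTop (l : ℕ) (ρ : F) (g : Matrix (Fin (2*l)) (Fin (2*l)) F) :
    Matrix (Fin (2*l+1)) (Fin (2*l+1)) F :=
  (Mtop F l ρ)⁻¹ * insTop F l g * Mtop F l ρ

/-- The conjugating matrix `M = diag(I_n, [[0,2],[1,0]], I_n)` (size `2n+2`). -/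
def Mlow (n : ℕ) : Matrix (Fin (2*n+2)) (Fin (2*n+2)) F :=
  Matrix.of fun i j =>
    if (i : ℕ) = n then (if (j : ℕ) = n + 1 then 2 else 0)
    else if (i : ℕ) = n + 1 then (if (j : ℕ) = n then 1 else 0)
    else if i = j then 1 else 0

/-- Insert a trivial `(n+2)`-nd row and column (1-indexed) into a `(2n+1) × (2n+1)` matrix. -/
def insLow (n : ℕ) (g : Matrix (Fin (2*n+1)) (Fin (2*n+1)) F) :
    Matrix (Fin (2*n+2)) (Fin (2*n+2)) F :=
  Matrix.of fun i j =>
    if hi : (i : ℕ) = n + 1 then (if (j : ℕ) = n + 1 then 1 else 0)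
    else if hj : (j : ℕ) = n + 1 then 0
    else
      g ⟨if (i : ℕ) < n + 1 then (i : ℕ) else (i : ℕ) - 1, by have := i.isLt; split <;> omega⟩
        ⟨if (j : ℕ) < n + 1 then (j : ℕ) else (j : ℕ) - 1, by have := j.isLt; split <;> omega⟩

/-- The middle `2n+2` block of the embedding of `SO_{2n+1}` into `SO_{2l}`. -/
def embLowMid (n : ℕ) (g : Matrix (Fin (2*n+1)) (Fin (2*n+1)) F) :
    Matrix (Fin (2*n+2)) (Fin (2*n+2)) F :=
  (Mlow F n)⁻¹ * insLow F n g * Mlow F n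

/-- The embedding of `SO_{2n+1}` into `SO_{2l}` (for `n < l`) at the matrix level. -/
def embLow (l n : ℕ) (g : Matrix (Fin (2*n+1)) (Fin (2*n+1)) F) :
    Matrix (Fin (2*l)) (Fin (2*l)) F :=
  Matrix.of fun i j =>
    if h : l - n - 1 ≤ (i : ℕ) ∧ (i : ℕ) < l + n + 1 ∧ l - n - 1 ≤ (j : ℕ) ∧ (j : ℕ) < l + n + 1
    then embLowMid F n g ⟨(i : ℕ) - (l - n - 1), by omega⟩ ⟨(j : ℕ) - (l - n - 1), by omega⟩
    else if i = j then 1 else 0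
/-- The maximal torus `T` of `SO_{2l}`. -/
def TSet (l : ℕ) (ρ : F) : Set (SO2l F l ρ) :=
  {g | ∃ (tv : ℕ → Fˣ) (a b : F), a^2 - b^2 * ρ = 1 ∧ mat F g = torusMat F l ρ tv a b}

/-- The split subtorus `S` of `T`. -/
def SSet (l : ℕ) (ρ : F) : Set (SO2l F l ρ) :=
  {g | ∃ tv : ℕ → Fˣ, mat F g = torusMat F l ρ tv 1 0}

/-- The standard Borel subgroup `B = T·U` of `SO_{2l}` (as a set). -/
def BorelSet (l : ℕ) (ρ : F) : Set (SO2l F l ρ) :=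
  {b | ∃ t ∈ TSet F l ρ, ∃ u ∈ USet F l ρ, b = t * u}

/-- `w` normalizes the torus `T`. -/
def NormalizesT (l : ℕ) (ρ : F) (w : SO2l F l ρ) : Prop :=
  ∀ t ∈ TSet F l ρ, w * t * w⁻¹ ∈ TSet F l ρ ∧ w⁻¹ * t * w ∈ TSet F l ρ

/-- Standard basis weight `e_k` (as an integral character vector). -/
def eVec (k : ℕ) : ℕ → ℤ := fun i => if i = k then 1 else 0

/-- The simple (restricted) roots of `SO_{2l}`: `α_k = e_k - e_{k+1}` for `k < l-2`
(0-indexed) and `α_{l-2} = e_{l-2}`. -/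
def simpleRoot (l k : ℕ) : ℕ → ℤ :=
  fun i => (if i = k then 1 else 0) - (if i = k + 1 ∧ k + 3 ≤ l then 1 else 0)

/-- The positive (restricted) roots of `SO_{2l}` (type `B_{l-1}`). -/
def posRoot (l : ℕ) : Set (ℕ → ℤ) :=
  {α | (∃ i j, i < j ∧ j < l - 1 ∧ α = fun k => eVec i k - eVec j k) ∨
       (∃ i j, i < j ∧ j < l - 1 ∧ α = fun k => eVec i k + eVec j k) ∨
       (∃ i, i < l - 1 ∧ α = eVec i)}

/-- Negative roots. -/
def negRoot (l : ℕ) : Set (ℕ → ℤ) := {α | (fun k => -(α k)) ∈ posRoot l}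

/-- Simple roots (as a set). -/
def isSimpleRoot (l : ℕ) (α : ℕ → ℤ) : Prop := ∃ k, k < l - 1 ∧ α = simpleRoot l k

/-- Evaluation of an integral character vector on an element of the split torus. -/
def rootEval (l : ℕ) (ρ : F) (α : ℕ → ℤ) (g : SO2l F l ρ) : F :=
  ∏ i : Fin (2*l), (if (i : ℕ) < l - 1 then (mat F g i i) ^ (α (i : ℕ)) else 1)

/-- The Weyl representative `w` maps the character `α` of `S` to the character `β`. -/
def mapsRoot (l : ℕ) (ρ : F) (w : SO2l F l ρ) (α β : ℕ → ℤ) : Prop :=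
  ∀ s ∈ SSet F l ρ, w⁻¹ * s * w ∈ SSet F l ρ ∧
    rootEval F l ρ β s = rootEval F l ρ α (w⁻¹ * s * w)

/-- The Weyl representative `w` supports Bessel functions: every simple root is mapped
to a negative or simple root. -/
def SupportsBessel (l : ℕ) (ρ : F) (w : SO2l F l ρ) : Prop :=
  ∀ k, k < l - 1 → ∃ β : ℕ → ℤ, mapsRoot F l ρ w (simpleRoot l k) β ∧
    (β ∈ negRoot l ∨ isSimpleRoot l β)

/-- `θ_w = {k : wα_k is positive}`. -/
def besselTheta (l : ℕ) (ρ : F) (w : SO2l F l ρ) : Set ℕ :=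
  {k | k < l - 1 ∧ ∃ β : ℕ → ℤ, mapsRoot F l ρ w (simpleRoot l k) β ∧ β ∈ posRoot l}

/-- The cell `B_n(SO_{2l}) = {t_n(w')·w̃_n : w' ∈ W(GL_n)}`. -/
def BnSet (l : ℕ) (ρ : F) (n : ℕ) : Set (SO2l F l ρ) :=
  {g | ∃ σ : Equiv.Perm (Fin n), mat F g = tnMat F l n (permMat F n σ) * wTildeMat F l n}

/-- Block index for the Siegel parabolic of `SO_{2n+1}`. -/
def blkSiegel (n i : ℕ) : ℕ := if i < n then 0 else if i = n then 1 else 2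

/-- The unipotent radical `V_n` of the Siegel parabolic of `SO_{2n+1}` (matrix level). -/
def VnSet (n : ℕ) : Set (Matrix (Fin (2*n+1)) (Fin (2*n+1)) F) :=
  {m | m ∈ SOset F (2*n+1) (Jmat F (2*n+1)) ∧
    ∀ i j : Fin (2*n+1), blkSiegel n (j : ℕ) ≤ blkSiegel n (i : ℕ) →
      m i j = if i = j then 1 else 0}

/-- The group `R^{l,n}` (matrix level). -/
def RlnSet (l : ℕ) (ρ : F) (n : ℕ) : Set (Matrix (Fin (2*l)) (Fin (2*l)) F) :=
  {m | m ∈ SOset F (2*l) (Jrho F l ρ) ∧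
    ∀ i j : Fin (2*l),
      ¬((n ≤ (i : ℕ) ∧ (i : ℕ) < l - 1 ∧ (j : ℕ) < n) ∨
        (2*l - n ≤ (i : ℕ) ∧ l + 1 ≤ (j : ℕ) ∧ (j : ℕ) < 2*l - n)) →
      m i j = if i = j then 1 else 0}

/-- The subgroup `N^{l-n} = U_{GL_{l-n-1}}·N_{l-n-1}` of `SO_{2l}`. -/
def NlnSet (l : ℕ) (ρ : F) (n : ℕ) : Set (SO2l F l ρ) :=
  {g | upUnip F (mat F g) ∧
    ∀ i j : Fin (2*l), l - n - 1 ≤ (i : ℕ) → (i : ℕ) < l + n + 1 →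
      l - n - 1 ≤ (j : ℕ) → (j : ℕ) < l + n + 1 →
      mat F g i j = if i = j then 1 else 0}

/-- Block index for standard parabolic subgroups of `SO_{2m+1}`, given cuts `C`. -/
def blkB (m : ℕ) (C : Finset ℕ) (i : ℕ) : ℕ :=
  (C.filter (fun c => c ≤ i)).card + (C.filter (fun c => 2*m + 1 - c ≤ i)).card

/-- The standard parabolic subgroup of `SO_{2m+1}` given by cuts `C` (as a set). -/
def pbP (m : ℕ) (C : Finset ℕ) : Set (SOodd F m) :=
  {g | ∀ i j : Fin (2*m+1), blkB m C (j : ℕ) < blkB m C (i : ℕ) → mat F g i j = 0}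

/-- The unipotent radical of the standard parabolic subgroup of `SO_{2m+1}` given by cuts `C`. -/
def pbV (m : ℕ) (C : Finset ℕ) : Set (SOodd F m) :=
  {g | ∀ i j : Fin (2*m+1), blkB m C (j : ℕ) ≤ blkB m C (i : ℕ) →
    mat F g i j = if i = j then 1 else 0}
/-- Apply a representation of `GL_n(F)` at a plain matrix (zero if not invertible). -/
def tauApp (n : ℕ) {Wτ : Type*} [AddCommGroup Wτ] [Module ℂ Wτ]
    (τ : Representation ℂ (GL (Fin n) F) Wτ) (m : Matrix (Fin n) (Fin n) F) :
    Wτ →ₗ[ℂ] Wτ :=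
  matFun (fun g : GL (Fin n) F => (g : Matrix (Fin n) (Fin n) F)) (fun g => τ g) m

/-- `Λ` is a nonzero `ψ⁻¹`-Whittaker functional for the representation `τ` of `GL_n(F)`. -/
def IsGenericGLinv (n : ℕ) (ψ : AddChar F ℂ) {Wτ : Type*} [AddCommGroup Wτ] [Module ℂ Wτ]
    (τ : Representation ℂ (GL (Fin n) F) Wτ) (Λ : Wτ →ₗ[ℂ] ℂ) : Prop :=
  Λ ≠ 0 ∧ ∀ u : GL (Fin n) F, upUnip F ((u : Matrix (Fin n) (Fin n) F)) →
    ∀ x : Wτ, Λ (τ u x) = ψ (-(glUSum F n (u : Matrix (Fin n) (Fin n) F))) * Λ x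

/-- The induced space `I(τ) = Ind_{Q_n}^{SO_{2n+1}} τ` (matrix level). -/
def IndTau (n : ℕ) {Wτ : Type*} [AddCommGroup Wτ] [Module ℂ Wτ]
    (τ : Representation ℂ (GL (Fin n) F) Wτ) :
    Set (Matrix (Fin (2*n+1)) (Fin (2*n+1)) F → Wτ) :=
  {ξ | (∀ g, g ∉ SOset F (2*n+1) (Jmat F (2*n+1)) → ξ g = 0) ∧
    ∀ a : GL (Fin n) F, ∀ u ∈ VnSet F n, ∀ g,
      ξ (lnMat F n (a : Matrix (Fin n) (Fin n) F) * u * g) = τ a (ξ g)}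

/-- The space `I(τ, ψ⁻¹)` spanned by the functions `f_ξ(g,a) = Λ(τ(a)ξ(g))`. -/
def Imodel (n : ℕ) {Wτ : Type*} [AddCommGroup Wτ] [Module ℂ Wτ]
    (τ : Representation ℂ (GL (Fin n) F) Wτ) (Λ : Wτ →ₗ[ℂ] ℂ) :
    Set (Matrix (Fin (2*n+1)) (Fin (2*n+1)) F → Matrix (Fin n) (Fin n) F → ℂ) :=
  {f | ∃ ξ ∈ IndTau F n τ, f = fun g a => Λ (tauApp F n τ a (ξ g))}

open Classical in
/-- The section `ξ_v ∈ I(τ)` supported on the Siegel parabolic with `ξ_v(l_n(a)u) = τ(a)v`. -/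
def xiv (n : ℕ) {Wτ : Type*} [AddCommGroup Wτ] [Module ℂ Wτ]
    (τ : Representation ℂ (GL (Fin n) F) Wτ) (v : Wτ) :
    Matrix (Fin (2*n+1)) (Fin (2*n+1)) F → Wτ :=
  fun m =>
    if h : ∃ p : (GL (Fin n) F) × Matrix (Fin (2*n+1)) (Fin (2*n+1)) F,
        p.2 ∈ VnSet F n ∧ m = lnMat F n ((p.1 : Matrix (Fin n) (Fin n) F)) * p.2
    then τ h.choose.1 v else 0

/-- The function `f_v = f_{ξ_v} ∈ I(τ, ψ⁻¹)`. -/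
def fvFun (n : ℕ) {Wτ : Type*} [AddCommGroup Wτ] [Module ℂ Wτ]
    (τ : Representation ℂ (GL (Fin n) F) Wτ) (Λ : Wτ →ₗ[ℂ] ℂ) (v : Wτ) :
    Matrix (Fin (2*n+1)) (Fin (2*n+1)) F → Matrix (Fin n) (Fin n) F → ℂ :=
  fun g a => Λ (tauApp F n τ a (xiv F n τ v g))

/-- The intertwining operator `M(τ, ψ⁻¹)` at the level of functions. -/
def MOp (n : ℕ)
    (f : Matrix (Fin (2*n+1)) (Fin (2*n+1)) F → Matrix (Fin n) (Fin n) F → ℂ) :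
    Matrix (Fin (2*n+1)) (Fin (2*n+1)) F → Matrix (Fin n) (Fin n) F → ℂ :=
  fun h a => ∑ᶠ u ∈ VnSet F n, f (wnOddMat F n * u * h) (dnMat F n * aStar F n a)

/-- The zeta integral for `n < l`, via the embedding `SO_{2n+1} → SO_{2l}`
(the sum over coset representatives is realized as `|U|⁻¹` times the full sum). -/
def ZetaLow (l : ℕ) (ρ : F) (n : ℕ) (φ : SO2l F l ρ → ℂ)
    (f : Matrix (Fin (2*n+1)) (Fin (2*n+1)) F → Matrix (Fin n) (Fin n) F → ℂ) : ℂ :=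
  (Nat.card (UoddMatSet F n) : ℂ)⁻¹ *
    ∑ᶠ g ∈ SOset F (2*n+1) (Jmat F (2*n+1)),
      (∑ᶠ r ∈ RlnSet F l ρ n,
        matFun (fun x : SO2l F l ρ => mat F x) φ
          (r * wlnMat F l n * embLow F l n g * (wlnMat F l n)⁻¹)) * f g 1

/-- The zeta integral for `n = l`, via the embedding `SO_{2l} → SO_{2l+1}`. -/
def ZetaTop (l : ℕ) (ρ : F) (φ : SO2l F l ρ → ℂ)
    (f : Matrix (Fin (2*l+1)) (Fin (2*l+1)) F → Matrix (Fin l) (Fin l) F → ℂ) : ℂ :=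
  (Nat.card (USet F l ρ) : ℂ)⁻¹ *
    ∑ᶠ g : SO2l F l ρ, φ g * f (wllMat F l ρ * embTop F l ρ (mat F g)) 1

/-- The combined zeta integral `Ψ` for `1 ≤ n ≤ l`. -/
def Zeta (l : ℕ) (ρ : F) (n : ℕ) (φ : SO2l F l ρ → ℂ)
    (f : Matrix (Fin (2*n+1)) (Fin (2*n+1)) F → Matrix (Fin n) (Fin n) F → ℂ) : ℂ :=
  if n < l then ZetaLow F l ρ n φ f
  else if h : n = l then ZetaTop F l ρ φ (cast (by rw [h]) f)
  else 0

/-- `c` is the gamma factor `γ(π × τ, ψ)`: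
`c · Ψ(W_v, f) = Ψ(W_v, M(τ,ψ⁻¹) f)` for all Whittaker functions `W_v` of `π`
and all `f ∈ I(τ, ψ⁻¹)`. -/
def IsGamma (l : ℕ) (ρ : F) (n : ℕ) {V : Type*} [AddCommGroup V] [Module ℂ V]
    (π : Representation ℂ (SO2l F l ρ) V) (Γ : V →ₗ[ℂ] ℂ)
    {Wτ : Type*} [AddCommGroup Wτ] [Module ℂ Wτ]
    (τ : Representation ℂ (GL (Fin n) F) Wτ) (Λ : Wτ →ₗ[ℂ] ℂ) (c : ℂ) : Prop :=
  ∀ v : V, ∀ f ∈ Imodel F n τ Λ,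
    c * Zeta F l ρ n (fun g => Γ (π g v)) f =
      Zeta F l ρ n (fun g => Γ (π g v)) (MOp F n f)

/-- The Bessel function of the conjugate representation `π^c`:
`B_{π^c,ψ}(g) = B_{π,ψ}(c·t̃⁻¹·g·t̃·c)`. -/
def BesselConj (l : ℕ) (ρ : F) (B : SO2l F l ρ → ℂ) : SO2l F l ρ → ℂ :=
  fun g => matFun (fun x : SO2l F l ρ => mat F x) B
    (cMat F l * (tTildeMat F l)⁻¹ * mat F g * tTildeMat F l * cMat F l)

section SingleMul

variable {F : Type} [Field F] {m : ℕ}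

theorem mul_single_of_col (M : Matrix (Fin m) (Fin m) F) {i k : Fin m} {d : F}
    (h : ∀ r, M r i = if r = k then d else 0) (j : Fin m) (c : F) :
    M * single i j c = single k j (d * c) := by
  ext r s
  by_cases hs : s = j
  · subst hs
    rw [mul_single_apply_same, h, single_apply]
    by_cases hr : r = k
    · simp [hr]
    · simp [hr, Ne.symm hr]
  · rw [mul_single_apply_of_ne (hbj := hs), single_apply_of_col_ne _ _ (Ne.symm hs)]

theorem mul_single_of_col_add (M : Matrix (Fin m) (Fin m) F) {i k k' : Fin m} {d d' : F}
    (h : ∀ r, M r i = (if r = k then d else 0) + if r = k' then d' else 0) (j : Fin m) (c : F) :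
    M * single i j c = single k j (d * c) + single k' j (d' * c) := by
  ext r s
  by_cases hs : s = j
  · subst hs
    rw [mul_single_apply_same, h, Matrix.add_apply, single_apply, single_apply]
    by_cases hr : r = k <;> by_cases hr' : r = k' <;>
      simp [hr, hr', add_mul, eq_comm]
    all_goals simp_all [eq_comm]
  · rw [mul_single_apply_of_ne (hbj := hs), Matrix.add_apply, single_apply_of_col_ne _ _ (Ne.symm hs),
      single_apply_of_col_ne _ _ (Ne.symm hs), add_zero]

theorem smul_single_one (i j : Fin m) (c : F) : c • single i j (1 : F) = single i j c := by
  simp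

theorem single_mul_of_row (M : Matrix (Fin m) (Fin m) F) {j k : Fin m} {d : F}
    (h : ∀ r, M j r = if r = k then d else 0) (i : Fin m) (c : F) :
    single i j c * M = single i k (d * c) := by
  have := congrArg Matrix.transpose (mul_single_of_col Mᵀ (i := j) (k := k) (d := d) h i c)
  simpa [transpose_mul] using this

theorem single_mul_of_row_add (M : Matrix (Fin m) (Fin m) F) {j k k' : Fin m} {d d' : F}
    (h : ∀ r, M j r = (if r = k then d else 0) + if r = k' then d' else 0) (i : Fin m) (c : F) :
    single i j c * M = single i k (d * c) + single i k' (d' * c) := by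
  have := congrArg Matrix.transpose
    (mul_single_of_col_add Mᵀ (i := j) (k := k) (k' := k') (d := d) (d' := d') h i c)
  simpa [transpose_mul] using this

end SingleMul

section Form

variable {F : Type} [Field F] {l : ℕ} {ρ : F}

theorem Jrho_apply (i j : Fin (2 * l)) :
    Jrho F l ρ i j = if (i : ℕ) + 1 = l then (if j = i then 1 else 0)
      else if (i : ℕ) = l then (if j = i then -ρ else 0)
      else if (i : ℕ) + (j : ℕ) + 1 = 2 * l then 1 else 0 := by
  have hi := i.isLt
  have hj := j.isLt
  have hmul (k : Fin (2 * l)) (hk : ∀ s, s ≠ k → Dmat F l ρ i s = 0) :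
      Jrho F l ρ i j = Dmat F l ρ i k * Jmat F (2 * l) k j := by
    rw [Jrho, Matrix.mul_apply, Finset.sum_eq_single k]
    · intro s _ hs
      rw [hk s hs, zero_mul]
    · simp
  split_ifs
  · rw [hmul ⟨l, by omega⟩ (by intro s hs; simp [Dmat]; grind)]
    simp [Dmat, Jmat]; grind
  · rw [hmul ⟨l, by omega⟩ (by intro s hs; simp [Dmat]; grind)]
    simp [Dmat, Jmat]; grind
  · rw [hmul ⟨l - 1, by omega⟩ (by intro s hs; simp [Dmat]; grind)]
    simp [Dmat, Jmat]; grind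
  · rw [hmul ⟨l - 1, by omega⟩ (by intro s hs; simp [Dmat]; grind)]
    simp [Dmat, Jmat]; grind
  · rw [hmul i (by intro s hs; simp [Dmat]; grind)]
    simp [Dmat, Jmat]; grind
  · rw [hmul i (by intro s hs; simp [Dmat]; grind)]
    simp [Dmat, Jmat]; grind

theorem Jrho_transpose : (Jrho F l ρ)ᵀ = Jrho F l ρ := by
  ext i j
  have hi := i.isLt
  have hj := j.isLt
  rw [transpose_apply, Jrho_apply, Jrho_apply]
  grind

theorem Jrho_mul_single {i i' : Fin (2 * l)} (h : (i : ℕ) + (i' : ℕ) + 1 = 2 * l)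
    (h1 : (i : ℕ) + 1 ≠ l) (h2 : (i : ℕ) ≠ l) (j : Fin (2 * l)) (c : F) :
    Jrho F l ρ * single i j c = single i' j c := by
  rw [mul_single_of_col (d := 1) (k := i'), one_mul]
  intro r
  rw [Jrho_apply]
  grind

theorem Jrho_mul_single_pred {i : Fin (2 * l)} (h : (i : ℕ) + 1 = l) (j : Fin (2 * l)) (c : F) :
    Jrho F l ρ * single i j c = single i j c := by
  rw [mul_single_of_col (d := 1) (k := i), one_mul]
  intro r
  rw [Jrho_apply]
  grind

theorem Jrho_mul_single_mid {i : Fin (2 * l)} (h : (i : ℕ) = l) (j : Fin (2 * l)) (c : F) :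
    Jrho F l ρ * single i j c = single i j (-ρ * c) := by
  rw [mul_single_of_col (d := -ρ) (k := i)]
  intro r
  rw [Jrho_apply]
  grind

theorem preserves_form_one_add {N P : Matrix (Fin (2 * l)) (Fin (2 * l)) F}
    (hP : Jrho F l ρ * N = P) (h : Pᵀ + P + Nᵀ * P = 0) :
    (1 + N)ᵀ * Jrho F l ρ * (1 + N) = Jrho F l ρ := by
  have hP' : Nᵀ * Jrho F l ρ = Pᵀ := by
    rw [← hP, transpose_mul, Jrho_transpose]
  calc (1 + N)ᵀ * Jrho F l ρ * (1 + N)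
      = Jrho F l ρ + (Nᵀ * Jrho F l ρ + Jrho F l ρ * N + Nᵀ * (Jrho F l ρ * N)) := by
        rw [transpose_add, transpose_one]; noncomm_ring
    _ = Jrho F l ρ := by rw [hP', hP, h, add_zero]

theorem exists_mem_USet {M : Matrix (Fin (2 * l)) (Fin (2 * l)) F} (hM : upUnip F M)
    (h : Mᵀ * Jrho F l ρ * M = Jrho F l ρ) : ∃ u ∈ USet F l ρ, mat F u = M := by
  have hdet : M.det = 1 := by
    rw [det_of_isUpperTriangular]
    · exact Finset.prod_eq_one fun i _ => by simp [hM i i le_rfl]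
    · intro i j hij
      have hij' : (j : ℕ) < i := hij
      rw [hM i j hij'.le, if_neg (by rintro rfl; exact lt_irrefl _ hij')]
  refine ⟨⟨GeneralLinearGroup.mkOfDetNeZero M (by simp [hdet]), hdet, h⟩, hM, rfl⟩

theorem upUnip_one_add {m : ℕ} {N : Matrix (Fin m) (Fin m) F}
    (h : ∀ i j : Fin m, (j : ℕ) ≤ (i : ℕ) → N i j = 0) : upUnip F (1 + N) := by
  intro i j hij
  rw [Matrix.add_apply, h i j hij, add_zero, one_apply]

end Form

section Character

variable {F : Type} [Field F] {l : ℕ}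

/-- The additive functional underlying the generic character of `U`. -/
def genericSum (l : ℕ) (M : Matrix (Fin (2*l)) (Fin (2*l)) F) : F :=
  ∑ i : Fin (2*l), ∑ j : Fin (2*l),
    (if (j : ℕ) = (i : ℕ) + 1 ∧ (i : ℕ) + 3 ≤ l then M i j
     else if (i : ℕ) + 2 = l ∧ (j : ℕ) = l then (2 : F)⁻¹ * M i j else 0)

theorem genericSum_add (M N : Matrix (Fin (2*l)) (Fin (2*l)) F) :
    genericSum l (M + N) = genericSum l M + genericSum l N := by
  simp only [genericSum, ← Finset.sum_add_distrib]
  refine Finset.sum_congr rfl fun i _ => Finset.sum_congr rfl fun j _ => ?_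
  split_ifs <;> simp [mul_add]

theorem genericSum_one : genericSum l (1 : Matrix (Fin (2*l)) (Fin (2*l)) F) = 0 := by
  refine Finset.sum_eq_zero fun i _ => Finset.sum_eq_zero fun j _ => ?_
  rw [one_apply]
  grind

theorem genericSum_single (i j : Fin (2*l)) (c : F) :
    genericSum l (single i j c) =
      if (j : ℕ) = (i : ℕ) + 1 ∧ (i : ℕ) + 3 ≤ l then c
      else if (i : ℕ) + 2 = l ∧ (j : ℕ) = l then (2 : F)⁻¹ * c else 0 := by
  rw [genericSum, Finset.sum_eq_single i, Finset.sum_eq_single j]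
  · simp
  · intro s _ hs
    simp [single_apply_of_col_ne _ _ (Ne.symm hs)]
  · simp
  · intro r _ hr
    refine Finset.sum_eq_zero fun s _ => ?_
    simp [single_apply_of_row_ne (Ne.symm hr)]
  · simp

theorem psiU_eq (ψ : AddChar F ℂ) (M : Matrix (Fin (2*l)) (Fin (2*l)) F) :
    psiU F l ψ M = ψ (genericSum l M) := rfl

theorem eq_zero_of_addChar_mul_eq_one {ψ : AddChar F ℂ} (hψ : ψ ≠ 1) {c : F}
    (h : ∀ x, ψ (c * x) = 1) : c = 0 := by
  by_contra hc
  refine hψ (AddChar.ext _ _ fun x => ?_)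
  simpa [mul_inv_cancel_left₀ hc] using h (c⁻¹ * x)

theorem eq_of_addChar_mul_eq {ψ : AddChar F ℂ} (hψ : ψ ≠ 1) {c d : F}
    (h : ∀ x, ψ (c * x) = ψ (d * x)) : c = d := by
  refine sub_eq_zero.1 (eq_zero_of_addChar_mul_eq_one hψ fun x => ?_)
  rw [sub_mul, sub_eq_add_neg, AddChar.map_add_eq_mul, h, ← AddChar.map_add_eq_mul,
    add_neg_cancel, AddChar.map_zero_eq_one]

end Character

section RootElements

variable {F : Type} [Field F] {l : ℕ} {ρ : F}

/-- The nilpotent part of a root element for the simple root `e_k - e_{k+1}`. -/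
def longNil (k : ℕ) (hk : k + 2 < l) (x : F) : Matrix (Fin (2*l)) (Fin (2*l)) F :=
  single ⟨k, by omega⟩ ⟨k + 1, by omega⟩ x +
    single ⟨2*l - 2 - k, by omega⟩ ⟨2*l - 1 - k, by omega⟩ (-x)

/-- The nilpotent part of a root element for the short simple root. -/
def shortNil (hl : 2 ≤ l) (ρ y x : F) : Matrix (Fin (2*l)) (Fin (2*l)) F :=
  single ⟨l - 2, by omega⟩ ⟨l - 1, by omega⟩ y + single ⟨l - 2, by omega⟩ ⟨l, by omega⟩ x +
    single ⟨l - 1, by omega⟩ ⟨l + 1, by omega⟩ (-y) +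
    single ⟨l, by omega⟩ ⟨l + 1, by omega⟩ (x / ρ) +
    single ⟨l - 2, by omega⟩ ⟨l + 1, by omega⟩ ((x ^ 2 / ρ - y ^ 2) / 2)

theorem exists_longNil (k : ℕ) (hk : k + 2 < l) (x : F) :
    ∃ u ∈ USet F l ρ, mat F u = 1 + longNil k hk x := by
  refine exists_mem_USet (upUnip_one_add fun i j hij => ?_) (preserves_form_one_add
    (P := single ⟨2*l - 1 - k, by omega⟩ ⟨k + 1, by omega⟩ x +
      single ⟨k + 1, by omega⟩ ⟨2*l - 1 - k, by omega⟩ (-x)) ?_ ?_)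
  · rw [longNil, Matrix.add_apply, single_apply, single_apply]
    grind
  · rw [longNil, mul_add,
      Jrho_mul_single (i' := ⟨2*l - 1 - k, by omega⟩) (by simp; omega) (by simp; omega)
        (by simp; omega),
      Jrho_mul_single (i' := ⟨k + 1, by omega⟩) (by simp; omega) (by simp; omega)
        (by simp; omega)]
  · simp only [longNil, transpose_add, transpose_single, add_mul, mul_add]
    rw [single_mul_single_of_ne (h := by simp; omega), single_mul_single_of_ne (h := by simp; omega),
      single_mul_single_of_ne (h := by simp), single_mul_single_of_ne (h := by simp; omega)]
    simp only [← smul_single_one _ _ (-x), ← smul_single_one _ _ x]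
    module

theorem exists_shortNil (hl : 2 ≤ l) (h2 : (2 : F) ≠ 0) (hρ : ρ ≠ 0) (y x : F) :
    ∃ u ∈ USet F l ρ, mat F u = 1 + shortNil hl ρ y x := by
  refine exists_mem_USet (upUnip_one_add fun i j hij => ?_) (preserves_form_one_add
    (P := single ⟨l + 1, by omega⟩ ⟨l - 1, by omega⟩ y + single ⟨l + 1, by omega⟩ ⟨l, by omega⟩ x +
      single ⟨l - 1, by omega⟩ ⟨l + 1, by omega⟩ (-y) +
      single ⟨l, by omega⟩ ⟨l + 1, by omega⟩ (-x) +
      single ⟨l + 1, by omega⟩ ⟨l + 1, by omega⟩ ((x ^ 2 / ρ - y ^ 2) / 2)) ?_ ?_)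
  · simp only [shortNil, Matrix.add_apply, single_apply]
    grind
  · have hs (j : Fin (2 * l)) (c : F) := Jrho_mul_single (ρ := ρ) (i := ⟨l - 2, by omega⟩)
      (i' := ⟨l + 1, by omega⟩) (by simp; omega) (by simp; omega) (by simp; omega) j c
    simp only [shortNil, mul_add, hs]
    rw [Jrho_mul_single_pred (by simp; omega), Jrho_mul_single_mid rfl]
    congr 4
    field_simp
  · have e1 : l - 2 ≠ l - 1 := by omega
    have e2 : l - 2 ≠ l := by omega
    have e3 : l - 2 ≠ l + 1 := by omega
    have e4 : l - 1 ≠ l := by omega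
    have e5 : l - 1 ≠ l + 1 := by omega
    have e6 : l ≠ l + 1 := by omega
    simp only [shortNil, transpose_add, transpose_single, add_mul, mul_add, ne_eq, Fin.mk.injEq,
      e1, e2, e3, e4, e4.symm, e5, e6, not_false_eq_true, single_mul_single_of_ne,
      single_mul_single_same]
    simp only [← smul_single_one _ _ (-x), ← smul_single_one _ _ x, ← smul_single_one _ _ y,
      ← smul_single_one _ _ (-y), ← smul_single_one _ _ ((x ^ 2 / ρ - y ^ 2) / 2),
      ← smul_single_one _ _ (-y * -y), ← smul_single_one _ _ (x / ρ * -x)]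
    match_scalars <;> field_simp <;> ring

theorem genericSum_one_add_longNil (k : ℕ) (hk : k + 2 < l) (x : F) :
    genericSum l (1 + longNil k hk x) = x := by
  simp only [longNil, genericSum_add, genericSum_one, genericSum_single]
  grind

theorem genericSum_one_add_shortNil (hl : 2 ≤ l) (ρ y x : F) :
    genericSum l (1 + shortNil hl ρ y x) = 2⁻¹ * x := by
  simp only [shortNil, genericSum_add, genericSum_one, genericSum_single]
  grind

end RootElements

section Conjugation

variable {F : Type} [Field F] {l n : ℕ} {ρ : F}

theorem tnMat_mul_wTildeMat_row (a : Matrix (Fin n) (Fin n) F) {i : Fin (2*l)}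
    (h1 : n ≤ (i : ℕ)) (h2 : (i : ℕ) < 2*l - n) (r : Fin (2*l)) :
    (tnMat F l n a * wTildeMat F l n) i r =
      if r = i then (if (i : ℕ) + 1 = l then (-1) ^ n else 1) else 0 := by
  rw [Matrix.mul_apply, Finset.sum_eq_single i]
  · simp only [tnMat, wTildeMat, Matrix.of_apply]
    grind
  · intro s _ hs
    simp only [tnMat, Matrix.of_apply]
    grind
  · simp

theorem tnMat_mul_wTildeMat_col (hnl : n < l) (a : Matrix (Fin n) (Fin n) F) {i : Fin (2*l)}
    (h1 : n ≤ (i : ℕ)) (h2 : (i : ℕ) < 2*l - n) (r : Fin (2*l)) :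
    (tnMat F l n a * wTildeMat F l n) r i =
      if r = i then (if (i : ℕ) + 1 = l then (-1) ^ n else 1) else 0 := by
  rw [Matrix.mul_apply, Finset.sum_eq_single i]
  · simp only [tnMat, wTildeMat, Matrix.of_apply]
    grind
  · intro s _ hs
    have := s.isLt
    simp only [wTildeMat, Matrix.of_apply]
    grind
  · simp

theorem tnMat_mul_wTildeMat_mul_single (hnl : n < l) (a : Matrix (Fin n) (Fin n) F)
    {i : Fin (2*l)} (h1 : n ≤ (i : ℕ)) (h2 : (i : ℕ) < 2*l - n) (j : Fin (2*l)) (c : F) :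
    tnMat F l n a * wTildeMat F l n * single i j c =
      single i j ((if (i : ℕ) + 1 = l then (-1) ^ n else 1) * c) :=
  mul_single_of_col _ (tnMat_mul_wTildeMat_col hnl a h1 h2) j c

theorem single_mul_tnMat_mul_wTildeMat (a : Matrix (Fin n) (Fin n) F)
    {j : Fin (2*l)} (h1 : n ≤ (j : ℕ)) (h2 : (j : ℕ) < 2*l - n) (i : Fin (2*l)) (c : F) :
    single i j c * (tnMat F l n a * wTildeMat F l n) =
      single i j ((if (j : ℕ) + 1 = l then (-1) ^ n else 1) * c) :=
  single_mul_of_row _ (tnMat_mul_wTildeMat_row a h1 h2) i c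

theorem tnMat_mul_wTildeMat_mul_longNil (a : Matrix (Fin n) (Fin n) F) (k : ℕ) (hk : k + 2 < l)
    (hnk : n ≤ k) (x : F) :
    tnMat F l n a * wTildeMat F l n * longNil k hk x =
      longNil k hk x * (tnMat F l n a * wTildeMat F l n) := by
  rw [longNil, mul_add, add_mul, tnMat_mul_wTildeMat_mul_single (by omega) a hnk (by simp; omega),
    tnMat_mul_wTildeMat_mul_single (by omega) a (by simp; omega) (by simp; omega),
    single_mul_tnMat_mul_wTildeMat a (by simp; omega) (by simp; omega),
    single_mul_tnMat_mul_wTildeMat a (by simp; omega) (by simp; omega)]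
  grind

theorem tnMat_mul_wTildeMat_mul_shortNil (a : Matrix (Fin n) (Fin n) F) (hl : 2 ≤ l)
    (hnl : n < l - 1) (y x : F) :
    tnMat F l n a * wTildeMat F l n * shortNil hl ρ y x =
      shortNil hl ρ ((-1) ^ n * y) x * (tnMat F l n a * wTildeMat F l n) := by
  have hc (i : ℕ) (hi : i < 2 * l) (h1 : n ≤ i) (h2 : i < 2*l - n) (j : Fin (2*l)) (c : F) :=
    tnMat_mul_wTildeMat_mul_single (i := ⟨i, hi⟩) (by omega) a h1 h2 j c
  have hr (i : ℕ) (hi : i < 2 * l) (h1 : n ≤ i) (h2 : i < 2*l - n) (j : Fin (2*l)) (c : F) :=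
    single_mul_tnMat_mul_wTildeMat (j := ⟨i, hi⟩) a h1 h2 j c
  have hsq : ((-1 : F) ^ n) ^ 2 = 1 := by rw [← pow_mul, mul_comm, pow_mul]; simp
  simp only [shortNil, mul_add, add_mul]
  rw [hc (l - 2), hc (l - 1), hc (l - 2), hc l, hc (l - 2), hr (l - 1), hr l, hr (l + 1),
    hr (l + 1), hr (l + 1)]
  any_goals omega
  rw [mul_pow, hsq, one_mul, if_neg (by simp; omega), if_pos (by simp; omega),
    if_neg (by simp), if_neg (by simp; omega)]
  simp only [one_mul, ← mul_assoc, ← sq, hsq, mul_neg]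

theorem torusMat_mul_longNil (tv : ℕ → Fˣ) (a b : F) (k : ℕ) (hk : k + 2 < l) (x : F) :
    torusMat F l ρ tv a b * longNil k hk x =
      longNil k hk ((tv k : F) * (tv (k + 1) : F)⁻¹ * x) * torusMat F l ρ tv a b := by
  rw [longNil, longNil, mul_add, add_mul,
    mul_single_of_col (k := ⟨k, by omega⟩) (d := (tv k : F)),
    mul_single_of_col (k := ⟨2*l - 2 - k, by omega⟩) (d := (tv (k + 1) : F)⁻¹),
    single_mul_of_row (k := ⟨k + 1, by omega⟩) (d := (tv (k + 1) : F)),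
    single_mul_of_row (k := ⟨2*l - 1 - k, by omega⟩) (d := (tv k : F)⁻¹)]
  · have h1 := (tv k).ne_zero
    have h2 := (tv (k + 1)).ne_zero
    congr 2 <;> field_simp
  all_goals
    intro r
    have := r.isLt
    simp only [torusMat, Matrix.of_apply]
    try rw [show 2 * l - 1 - (2 * l - 1 - k) = k by omega]
    grind

theorem torusMat_mul_shortNil (tv : ℕ → Fˣ) {a b : F} (hab : a ^ 2 - b ^ 2 * ρ = 1)
    (hl : 2 ≤ l) (h2 : (2 : F) ≠ 0) (hρ : ρ ≠ 0) (y x : F) :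
    torusMat F l ρ tv a b * shortNil hl ρ y x =
      shortNil hl ρ ((tv (l - 2) : F) * (a * y - b * x)) ((tv (l - 2) : F) * (a * x - b * ρ * y)) *
        torusMat F l ρ tv a b := by
  have c1 (j : Fin (2*l)) (c : F) := mul_single_of_col (torusMat F l ρ tv a b)
    (i := ⟨l - 2, by omega⟩) (k := ⟨l - 2, by omega⟩) (d := (tv (l - 2) : F)) (by
      intro r; have := r.isLt; simp only [torusMat, Matrix.of_apply]; grind) j c
  have c2 (j : Fin (2*l)) (c : F) := mul_single_of_col_add (torusMat F l ρ tv a b)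
    (i := ⟨l - 1, by omega⟩) (k := ⟨l - 1, by omega⟩) (k' := ⟨l, by omega⟩) (d := a) (d' := b) (by
      intro r; have := r.isLt; simp only [torusMat, Matrix.of_apply]; grind) j c
  have c3 (j : Fin (2*l)) (c : F) := mul_single_of_col_add (torusMat F l ρ tv a b)
    (i := ⟨l, by omega⟩) (k := ⟨l - 1, by omega⟩) (k' := ⟨l, by omega⟩) (d := b * ρ) (d' := a) (by
      intro r; have := r.isLt; simp only [torusMat, Matrix.of_apply]; grind) j c
  have r1 (i : Fin (2*l)) (c : F) := single_mul_of_row (torusMat F l ρ tv a b)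
    (j := ⟨l + 1, by omega⟩) (k := ⟨l + 1, by omega⟩) (d := (tv (l - 2) : F)⁻¹) (by
      intro r; have := r.isLt; simp only [torusMat, Matrix.of_apply]
      rw [show 2 * l - 1 - (l + 1) = l - 2 by omega]; grind) i c
  have r2 (i : Fin (2*l)) (c : F) := single_mul_of_row_add (torusMat F l ρ tv a b)
    (j := ⟨l - 1, by omega⟩) (k := ⟨l - 1, by omega⟩) (k' := ⟨l, by omega⟩) (d := a)
    (d' := b * ρ) (by
      intro r; have := r.isLt; simp only [torusMat, Matrix.of_apply]; grind) i c
  have r3 (i : Fin (2*l)) (c : F) := single_mul_of_row_add (torusMat F l ρ tv a b)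
    (j := ⟨l, by omega⟩) (k := ⟨l - 1, by omega⟩) (k' := ⟨l, by omega⟩) (d := b) (d' := a) (by
      intro r; have := r.isLt; simp only [torusMat, Matrix.of_apply]; grind) i c
  have ht := (tv (l - 2)).ne_zero
  have hs (i j : Fin (2*l)) (c d : F) :
      single i j (c * d) = (c * d) • (single i j 1 : Matrix (Fin (2*l)) (Fin (2*l)) F) :=
    (smul_single_one i j (c * d)).symm
  simp only [shortNil, mul_add, add_mul, c1, c2, c3, r1, r2, r3]
  simp only [hs]
  match_scalars
  · linear_combination (-(tv (l - 2) : F) * y) * hab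
  · linear_combination (-(tv (l - 2) : F) * x) * hab
  · field_simp
    ring
  · field_simp
    ring
  · field_simp
    linear_combination (-(x ^ 2 - y ^ 2 * ρ)) * hab

end Conjugation

theorem psiU_eq_of_bessel_ne_zero {F : Type} [Field F] [Fintype F] {ψ : AddChar F ℂ} {l : ℕ}
    {ρ : F} {V : Type} [AddCommGroup V] [Module ℂ V] {π : Representation ℂ (SO2l F l ρ) V}
    {Γ : V →ₗ[ℂ] ℂ} (hΓ : IsWhittaker F l ρ ψ π Γ) {v₀ : V} (hv₀ : IsWhitVec F l ρ ψ π Γ v₀)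
    {g u u' : SO2l F l ρ} (hu : u ∈ USet F l ρ) (hu' : u' ∈ USet F l ρ)
    (h : mat F g * mat F u = mat F u' * mat F g) (hB : Bessel F l ρ π Γ v₀ g ≠ 0) :
    psiU F l ψ (mat F u) = psiU F l ψ (mat F u') := by
  have hg : g * u = u' * g := Subtype.ext (Units.ext h)
  have hne : Γ (π g v₀) ≠ 0 := fun h0 => hB (by simp [Bessel, h0])
  refine mul_right_cancel₀ hne ?_
  have h1 : Γ (π (g * u) v₀) = psiU F l ψ (mat F u) * Γ (π g v₀) := by
    rw [map_mul, Module.End.mul_apply, hv₀.2 u hu, map_smul, map_smul, smul_eq_mul]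
  have h2 : Γ (π (u' * g) v₀) = psiU F l ψ (mat F u') * Γ (π g v₀) := by
    rw [map_mul, Module.End.mul_apply, hΓ.2 u' hu']
  rw [← h1, ← h2, hg]

theorem bessel_support_on_cells
    (F : Type) [Field F] [Fintype F] (p r : ℕ) (hp : p.Prime) (hp2 : p ≠ 2)
    (hr : 0 < r) (hcard : Fintype.card F = p ^ r)
    (ψ : AddChar F ℂ) (hψ : ψ ≠ 1)
    (l : ℕ) (hl : 2 ≤ l) (ρ : F) (hρ : ∀ x : F, x ^ 2 ≠ ρ)
    (V : Type) [AddCommGroup V] [Module ℂ V]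
    (π : Representation ℂ (SO2l F l ρ) V)
    (hπirr : IsIrrep π)
    (Γ : V →ₗ[ℂ] ℂ) (hΓ : IsWhittaker F l ρ ψ π Γ)
    (v₀ : V) (hv₀ : IsWhitVec F l ρ ψ π Γ v₀)
    (n : ℕ) (hn1 : 1 ≤ n) (hnl : n < l - 1)
    (σp : Equiv.Perm (Fin n)) (w : SO2l F l ρ)
    (hw : mat F w = tnMat F l n (permMat F n σp) * wTildeMat F l n)
    (tv : ℕ → Fˣ) (a b : F) (hab : a ^ 2 - b ^ 2 * ρ = 1)
    (t : SO2l F l ρ) (ht : mat F t = torusMat F l ρ tv a b)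
    (hB : Bessel F l ρ π Γ v₀ (t * w) ≠ 0) :
    (∀ k, n + 1 ≤ k → k ≤ l - 1 → (tv (k - 1) : F) = a) ∧ (a = 1 ∨ a = -1) ∧ b = 0 := by
  have h2 : (2 : F) ≠ 0 := by
    have : Fact p.Prime := ⟨hp⟩
    have : CharP F p := charP_of_card_eq_prime_pow hcard
    exact Ring.two_ne_zero (by rwa [ringChar.eq F p])
  have hρ0 : ρ ≠ 0 := fun h => hρ 0 (by simp [h])
  have hconj {N N' N'' : Matrix (Fin (2 * l)) (Fin (2 * l)) F}
      (h1 : tnMat F l n (permMat F n σp) * wTildeMat F l n * N =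
        N' * (tnMat F l n (permMat F n σp) * wTildeMat F l n))
      (h2 : torusMat F l ρ tv a b * N' = N'' * torusMat F l ρ tv a b)
      (hu : ∃ u ∈ USet F l ρ, mat F u = 1 + N) (hu' : ∃ u ∈ USet F l ρ, mat F u = 1 + N'') :
      ψ (genericSum l (1 + N)) = ψ (genericSum l (1 + N'')) := by
    obtain ⟨u, hu, hN⟩ := hu
    obtain ⟨u', hu', hN'⟩ := hu'
    rw [← psiU_eq, ← psiU_eq, ← hN, ← hN']
    refine psiU_eq_of_bessel_ne_zero hΓ hv₀ hu hu' ?_ hB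
    rw [show mat F (t * w) = mat F t * mat F w from rfl, hN, hN', ht, hw, mul_add, add_mul,
      mul_one, one_mul, Matrix.mul_assoc, h1, ← Matrix.mul_assoc _ N', h2, Matrix.mul_assoc]
  have hlong (k : ℕ) (hnk : n ≤ k) (hk : k + 2 < l) : (tv k : F) = tv (k + 1) := by
    have hx : (1 : F) = (tv k : F) * (tv (k + 1) : F)⁻¹ := eq_of_addChar_mul_eq hψ fun x => by
      have := hconj (tnMat_mul_wTildeMat_mul_longNil _ k hk hnk x)
        (torusMat_mul_longNil tv a b k hk x) (exists_longNil k hk x) (exists_longNil k hk _)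
      rwa [genericSum_one_add_longNil, genericSum_one_add_longNil, ← one_mul x, ← mul_assoc,
        mul_one] at this
    have := (tv (k + 1)).ne_zero
    field_simp at hx
    exact hx.symm
  have hshort (y x : F) : ψ (2⁻¹ * x) =
      ψ (2⁻¹ * ((tv (l - 2) : F) * (a * x - b * ρ * ((-1) ^ n * y)))) := by
    have := hconj (tnMat_mul_wTildeMat_mul_shortNil _ hl hnl y x)
      (torusMat_mul_shortNil tv hab hl h2 hρ0 _ x) (exists_shortNil hl h2 hρ0 y x)
      (exists_shortNil hl h2 hρ0 _ _)
    rwa [genericSum_one_add_shortNil, genericSum_one_add_shortNil] at this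
  have ht0 := (tv (l - 2)).ne_zero
  have hta : (tv (l - 2) : F) * a = 1 := by
    have : (2⁻¹ : F) = 2⁻¹ * (tv (l - 2) * a) := eq_of_addChar_mul_eq hψ fun x => by
      rw [hshort 0 x]
      congr 1
      ring
    field_simp at this
    exact this.symm
  have hb : b = 0 := by
    have : 2⁻¹ * (tv (l - 2) : F) * (b * ρ * (-1) ^ n) = 0 :=
      eq_zero_of_addChar_mul_eq_one hψ fun y => by
        have := hshort (-y) 0
        rw [mul_zero, AddChar.map_zero_eq_one] at this
        rw [this]
        congr 1
        ring
    simpa [h2, hρ0, ht0] using this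
  have ha : a ^ 2 = 1 := by simpa [hb] using hab
  have hlast : (tv (l - 2) : F) = a := by
    linear_combination a * hta - (tv (l - 2) : F) * ha
  have hall (d : ℕ) (hd : n + d ≤ l - 2) : (tv (l - 2 - d) : F) = a := by
    induction d with
    | zero => exact hlast
    | succ d ih =>
      rw [hlong (l - 2 - (d + 1)) (by omega) (by omega),
        show l - 2 - (d + 1) + 1 = l - 2 - d by omega]
      exact ih (by omega)
  refine ⟨fun k hk1 hk2 => ?_, by simpa using ha, hb⟩
  rw [show k - 1 = l - 2 - (l - 1 - k) by omega]
  exact hall _ (by omega)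

end ConverseSO
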